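/- arXiv:math/0101070 — 6 statements merged into one kernel-verified Lean document; each statement's English description precedes it below -/
import Mathlib

section
/- For every integer k ≥ 1 and every real α with 0 < α < 1, the function x ↦ x / (ln^∘k(x))^α is concave on the interval [T_{k,α}, ∞), where T_{k,α} = exp^∘k((4k)^{1/α}). -/
open Finset in
/-- The product `(log x) (log log x) ⋯ (log^[k] x)`. -/
noncomputable def iteratedLogProd (k : ℕ) (x : ℝ) : ℝ :=
  ∏ j ∈ range k, Real.log^[j + 1] x

open Finset in
/-- The sum of the reciprocals of `iteratedLogProd j x` for `1 ≤ j ≤ k`. -/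
noncomputable def iteratedLogSum (k : ℕ) (x : ℝ) : ℝ :=
  ∑ j ∈ range k, (iteratedLogProd (j + 1) x)⁻¹

lemma iteratedLogProd_succ (k : ℕ) (x : ℝ) :
    iteratedLogProd (k + 1) x = iteratedLogProd k x * Real.log^[k + 1] x := by
  simp only [iteratedLogProd, Finset.prod_range_succ]

lemma iteratedLogSum_succ (k : ℕ) (x : ℝ) :
    iteratedLogSum (k + 1) x = iteratedLogSum k x + (iteratedLogProd (k + 1) x)⁻¹ := by
  simp only [iteratedLogSum, Finset.sum_range_succ]

lemma le_iterate_exp (k : ℕ) (c : ℝ) : c ≤ Real.exp^[k] c := by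
  induction k with
  | zero => simp
  | succ k ih =>
    rw [Function.iterate_succ_apply']
    linarith [Real.add_one_le_exp (Real.exp^[k] c)]

lemma le_iterate_log_of_iterate_exp_le {c : ℝ} {k : ℕ} :
    ∀ {x : ℝ}, Real.exp^[k] c ≤ x → ∀ j ≤ k, c ≤ Real.log^[j] x := by
  induction k with
  | zero =>
    intro x hx j hj
    obtain rfl := Nat.le_zero.mp hj
    exact hx
  | succ k ih =>
    intro x hx j hj
    cases j with
    | zero => exact (le_iterate_exp _ c).trans hx
    | succ j =>
      rw [Function.iterate_succ_apply]
      rw [Function.iterate_succ_apply'] at hx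
      exact ih ((Real.le_log_iff_exp_le ((Real.exp_pos _).trans_le hx)).mpr hx) j (by omega)

lemma iteratedLogProd_pos {k : ℕ} {x : ℝ} (h : ∀ j ≤ k, 0 < Real.log^[j] x) :
    0 < iteratedLogProd k x :=
  Finset.prod_pos fun _ hj => h _ (Finset.mem_range.mp hj)

lemma le_iteratedLogProd {k : ℕ} {x c : ℝ} (hc : 1 ≤ c) (hk : 1 ≤ k)
    (h : ∀ j ≤ k, c ≤ Real.log^[j] x) : c ≤ iteratedLogProd k x := by
  induction k, hk using Nat.le_induction with
  | base => simpa [iteratedLogProd] using h 1 le_rfl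
  | succ k hk ih =>
    rw [iteratedLogProd_succ]
    nlinarith [ih fun j hj => h j (by omega), h (k + 1) le_rfl]

lemma iteratedLogSum_le {k : ℕ} {x c : ℝ} (hc : 1 ≤ c)
    (h : ∀ j ≤ k, c ≤ Real.log^[j] x) : iteratedLogSum k x ≤ k * c⁻¹ := by
  have hterm : ∀ j ∈ Finset.range k, (iteratedLogProd (j + 1) x)⁻¹ ≤ c⁻¹ := fun j hj =>
    inv_anti₀ (by linarith) (le_iteratedLogProd hc (by omega) fun i hi =>
      h i (hi.trans (Finset.mem_range.mp hj)))
  simpa [iteratedLogSum] using Finset.sum_le_card_nsmul _ _ _ hterm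

lemma hasDerivAt_iterate_log_succ {k : ℕ} {x : ℝ} (h : ∀ j ≤ k, 0 < Real.log^[j] x) :
    HasDerivAt (fun y => Real.log^[k + 1] y) (x * iteratedLogProd k x)⁻¹ x := by
  induction k with
  | zero =>
    have hx : 0 < x := h 0 le_rfl
    simpa [iteratedLogProd] using Real.hasDerivAt_log hx.ne'
  | succ k ih =>
    have hd := (ih fun j hj => h j (by omega)).log (h (k + 1) le_rfl).ne'
    simp only [← Function.iterate_succ_apply'] at hd
    convert hd using 1
    rw [iteratedLogProd_succ, ← mul_assoc, mul_inv, div_eq_mul_inv]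

lemma hasDerivAt_iteratedLogProd {k : ℕ} {x : ℝ} (h : ∀ j ≤ k, 0 < Real.log^[j] x) :
    HasDerivAt (iteratedLogProd k) (iteratedLogProd k x * iteratedLogSum k x / x) x := by
  induction k with
  | zero =>
    have : iteratedLogProd 0 = fun _ => 1 := by ext; simp [iteratedLogProd]
    simpa [this, iteratedLogSum] using hasDerivAt_const x (1 : ℝ)
  | succ k ih =>
    have h' : ∀ j ≤ k, 0 < Real.log^[j] x := fun j hj => h j (by omega)
    have hd := (ih h').mul (hasDerivAt_iterate_log_succ h')
    have hfun : iteratedLogProd (k + 1) = iteratedLogProd k * fun y => Real.log^[k + 1] y := by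
      ext y; exact iteratedLogProd_succ k y
    rw [← hfun] at hd
    refine hd.congr_deriv ?_
    have hx : 0 < x := h 0 (by omega)
    have hP := iteratedLogProd_pos h'
    have hL := h (k + 1) le_rfl
    rw [iteratedLogSum_succ, iteratedLogProd_succ]
    field_simp

lemma hasDerivAt_iterate_log_rpow_neg {k : ℕ} {x : ℝ} (α : ℝ) (hk : 1 ≤ k)
    (h : ∀ j ≤ k, 0 < Real.log^[j] x) :
    HasDerivAt (fun y => (Real.log^[k] y) ^ (-α))
      (-α * (Real.log^[k] x) ^ (-α) / (x * iteratedLogProd k x)) x := by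
  obtain ⟨k, rfl⟩ : ∃ m, k = m + 1 := ⟨k - 1, by omega⟩
  have h' : ∀ j ≤ k, 0 < Real.log^[j] x := fun j hj => h j (by omega)
  have hL := h (k + 1) le_rfl
  convert (hasDerivAt_iterate_log_succ h').rpow_const (p := -α) (Or.inl hL.ne') using 1
  have hx : 0 < x := h 0 (by omega)
  have hP := iteratedLogProd_pos h'
  rw [Real.rpow_sub_one hL.ne', iteratedLogProd_succ]
  field_simp

lemma hasDerivAt_mul_iterate_log_rpow_neg {k : ℕ} {x : ℝ} (α : ℝ) (hk : 1 ≤ k)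
    (h : ∀ j ≤ k, 0 < Real.log^[j] x) :
    HasDerivAt (fun y => y * (Real.log^[k] y) ^ (-α))
      ((Real.log^[k] x) ^ (-α) * (1 - α * (iteratedLogProd k x)⁻¹)) x := by
  refine ((hasDerivAt_id x).mul (hasDerivAt_iterate_log_rpow_neg α hk h)).congr_deriv ?_
  have hx : 0 < x := h 0 (by omega)
  have hP := iteratedLogProd_pos h
  simp only [id]
  field_simp
  ring

lemma hasDerivAt_deriv_mul_iterate_log_rpow_neg {k : ℕ} {x : ℝ} (α : ℝ) (hk : 1 ≤ k)
    (h : ∀ j ≤ k, 0 < Real.log^[j] x) :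
    HasDerivAt (fun y => (Real.log^[k] y) ^ (-α) * (1 - α * (iteratedLogProd k y)⁻¹))
      (-(α * (Real.log^[k] x) ^ (-α) / (x * iteratedLogProd k x) *
        (1 - α * (iteratedLogProd k x)⁻¹ - iteratedLogSum k x))) x := by
  have hx : 0 < x := h 0 (by omega)
  have hP := iteratedLogProd_pos h
  refine ((hasDerivAt_iterate_log_rpow_neg α hk h).mul
    ((((hasDerivAt_iteratedLogProd h).inv hP.ne').const_mul α).const_sub 1)).congr_deriv ?_
  simp only [Pi.inv_apply]
  field_simp
  ring

/-- For every integer `k ≥ 1` and every real `α` with `0 < α < 1`,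
the function `x ↦ x / (ln^[k] x)^α` is concave on the interval `[T_{k,α}, ∞)`,
where `T_{k,α} = exp^[k]((4k)^{1/α})` (the `k`-fold iterated exponential of `(4k)^{1/α}`). -/
theorem iterated_log_quotient_concave (k : ℕ) (hk : 1 ≤ k) (α : ℝ) (hα0 : 0 < α)
    (hα1 : α < 1) :
    ConcaveOn ℝ (Set.Ici (Real.exp^[k] (((4 * k : ℕ) : ℝ) ^ (1 / α))))
      (fun x : ℝ => x / (Real.log^[k] x) ^ α) := by
  have hk' : (1 : ℝ) ≤ k := by exact_mod_cast hk
  have hlog : ∀ x ∈ Set.Ici (Real.exp^[k] (((4 * k : ℕ) : ℝ) ^ (1 / α))),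
      ∀ j ≤ k, (4 * k : ℝ) ≤ Real.log^[j] x := by
    intro x hx j hj
    refine le_trans ?_ (le_iterate_log_of_iterate_exp_le hx j hj)
    push_cast
    exact Real.self_le_rpow_of_one_le (by linarith) ((one_le_div hα0).mpr hα1.le)
  have hpos : ∀ x ∈ Set.Ici (Real.exp^[k] (((4 * k : ℕ) : ℝ) ^ (1 / α))),
      ∀ j ≤ k, 0 < Real.log^[j] x := fun x hx j hj => by linarith [hlog x hx j hj]
  have hconc : ConcaveOn ℝ (Set.Ici (Real.exp^[k] (((4 * k : ℕ) : ℝ) ^ (1 / α))))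
      (fun x : ℝ => x * (Real.log^[k] x) ^ (-α)) := by
    refine concaveOn_of_hasDerivWithinAt2_nonpos (convex_Ici _)
      (fun x hx => (hasDerivAt_mul_iterate_log_rpow_neg α hk
        (hpos x hx)).continuousAt.continuousWithinAt)
      (fun x hx => (hasDerivAt_mul_iterate_log_rpow_neg α hk
        (hpos x (interior_subset hx))).hasDerivWithinAt)
      (fun x hx => (hasDerivAt_deriv_mul_iterate_log_rpow_neg α hk
        (hpos x (interior_subset hx))).hasDerivWithinAt)
      fun x hx => ?_
    have hlogx := hlog x (interior_subset hx)
    have hposx := hpos x (interior_subset hx)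
    have hx0 : 0 < x := hposx 0 (by omega)
    have hP := iteratedLogProd_pos hposx
    have hL := Real.rpow_pos_of_pos (hposx k le_rfl) (-α)
    have hsum : iteratedLogSum k x ≤ 1 / 4 := by
      refine (iteratedLogSum_le (by linarith) hlogx).trans (le_of_eq ?_)
      field_simp
    have hinv : (iteratedLogProd k x)⁻¹ ≤ 1 / 4 := by
      rw [one_div]
      exact inv_anti₀ (by norm_num)
        (by linarith [le_iteratedLogProd (by linarith) hk hlogx])
    have hinv0 : 0 < (iteratedLogProd k x)⁻¹ := inv_pos.mpr hP
    have hfactor : 0 ≤ 1 - α * (iteratedLogProd k x)⁻¹ - iteratedLogSum k x := by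
      nlinarith
    rw [neg_nonpos]
    positivity
  refine hconc.congr fun x hx => ?_
  simp only [Real.rpow_neg (hpos x hx k le_rfl).le, div_eq_mul_inv]
end

section
/- For every integer k ≥ 1, every real α with 0 < α < 1, and every real n ≥ 1, the function x ↦ 1 / (ln^∘k(n/x))^α is concave on the interval (0, n / T_{k,α}], where T_{k,α} = exp^∘k((4k)^{1/α}). -/
theorem ConcaveOn.comp_of_mapsTo {s t : Set ℝ} {f g : ℝ → ℝ} (hg : ConcaveOn ℝ t g)
    (hf : ConcaveOn ℝ s f) (hmono : MonotoneOn g t) (hmaps : Set.MapsTo f s t) :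
    ConcaveOn ℝ s (fun x => g (f x)) :=
  ⟨hf.1, fun _ hx _ hy _ _ ha hb hab =>
    (hg.2 (hmaps hx) (hmaps hy) ha hb hab).trans
      (hmono (hg.1 (hmaps hx) (hmaps hy) ha hb hab) (hmaps (hf.1 hx hy ha hb hab))
        (hf.2 hx hy ha hb hab))⟩

theorem Real.log_inv_ge_two_of_mem {x : ℝ} (hx : x ∈ Set.Ioc 0 (Real.exp (-2))) :
    2 ≤ Real.log x⁻¹ := by
  have := (Real.log_le_iff_le_exp hx.1).2 hx.2
  rw [Real.log_inv]
  linarith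

theorem Real.hasDerivAt_inv_log_inv {x : ℝ} (hx : 0 < x) (hlog : Real.log x ≠ 0) :
    HasDerivAt (fun y => (Real.log y⁻¹)⁻¹) (x * Real.log x ^ 2)⁻¹ x := by
  have h := ((Real.hasDerivAt_log hx.ne').neg).inv (neg_ne_zero.2 hlog)
  have hfun : (fun y => (Real.log y⁻¹)⁻¹) = (-Real.log)⁻¹ := by
    funext y
    simp [Real.log_inv]
  rw [hfun]
  refine h.congr_deriv ?_
  simp only [Pi.neg_apply]
  field_simp

theorem Real.monotoneOn_mul_log_sq :
    MonotoneOn (fun x => x * Real.log x ^ 2) (Set.Ioc 0 (Real.exp (-2))) := by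
  have hd : ∀ x ∈ Set.Ioc 0 (Real.exp (-2)), HasDerivAt (fun x => x * Real.log x ^ 2)
      (Real.log x * (Real.log x + 2)) x := by
    intro x hx
    have hx0 : x ≠ 0 := hx.1.ne'
    refine ((hasDerivAt_id x).mul ((Real.hasDerivAt_log hx0).pow 2)).congr_deriv ?_
    simp only [id_eq, Pi.pow_apply]
    field_simp
    ring
  refine monotoneOn_of_deriv_nonneg (convex_Ioc _ _)
    (fun x hx => (hd x hx).continuousAt.continuousWithinAt)
    (fun x hx => (hd x (interior_subset hx)).differentiableAt.differentiableWithinAt) ?_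
  intro x hx
  have hx' := interior_subset hx
  rw [(hd x hx').deriv]
  have := Real.log_inv_ge_two_of_mem hx'
  rw [Real.log_inv] at this
  exact mul_nonneg_of_nonpos_of_nonpos (by linarith) (by linarith)

theorem Real.monotoneOn_inv_log_inv :
    MonotoneOn (fun x => (Real.log x⁻¹)⁻¹) (Set.Ioc 0 (Real.exp (-2))) := by
  intro x hx y hy hxy
  have := Real.log_inv_ge_two_of_mem hy
  have hle : Real.log y⁻¹ ≤ Real.log x⁻¹ :=
    Real.log_le_log (inv_pos.2 hy.1) (inv_anti₀ hx.1 hxy)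
  exact inv_anti₀ (by linarith) hle

theorem Real.concaveOn_inv_log_inv :
    ConcaveOn ℝ (Set.Ioc 0 (Real.exp (-2))) (fun x => (Real.log x⁻¹)⁻¹) := by
  have hlog : ∀ x ∈ Set.Ioc 0 (Real.exp (-2)), Real.log x ≠ 0 := by
    intro x hx h
    have := Real.log_inv_ge_two_of_mem hx
    rw [Real.log_inv, h] at this
    norm_num at this
  have hd : ∀ x ∈ Set.Ioc 0 (Real.exp (-2)), HasDerivAt (fun y => (Real.log y⁻¹)⁻¹)
      (x * Real.log x ^ 2)⁻¹ x := fun x hx => Real.hasDerivAt_inv_log_inv hx.1 (hlog x hx)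
  refine AntitoneOn.concaveOn_of_deriv (convex_Ioc _ _)
    (fun x hx => (hd x hx).continuousAt.continuousWithinAt)
    (fun x hx => (hd x (interior_subset hx)).differentiableAt.differentiableWithinAt) ?_
  intro x hx y hy hxy
  have hx' := interior_subset hx
  have hy' := interior_subset hy
  rw [(hd x hx').deriv, (hd y hy').deriv]
  exact inv_anti₀ (mul_pos hx'.1 (sq_pos_of_ne_zero (hlog x hx')))
    (Real.monotoneOn_mul_log_sq hx' hy' hxy)

theorem Real.le_exp_iterate (c : ℝ) (k : ℕ) : c ≤ Real.exp^[k] c :=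
  Function.id_le_iterate_of_id_le (fun x => (lt_add_one x).le.trans (Real.add_one_le_exp x)) k c

/-- Inverting, each logarithm acts as the concave increasing map `y ↦ 1 / ln (1 / y)`. -/
theorem ConcaveOn.inv_log_iterate_inv {s : Set ℝ} {c : ℝ} (hc : 2 ≤ c) (k : ℕ) {f : ℝ → ℝ}
    (hf : ConcaveOn ℝ s f) (hpos : ∀ x ∈ s, 0 < f x)
    (hle : ∀ x ∈ s, Real.exp^[k] c ≤ (f x)⁻¹) :
    ConcaveOn ℝ s (fun x => (Real.log^[k] (f x)⁻¹)⁻¹) ∧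
      ∀ x ∈ s, c ≤ Real.log^[k] (f x)⁻¹ := by
  induction k generalizing f with
  | zero => exact ⟨by simpa using hf, hle⟩
  | succ k ih =>
    simp only [Function.iterate_succ_apply'] at hle
    simp only [Function.iterate_succ_apply]
    have hmaps : Set.MapsTo f s (Set.Ioc 0 (Real.exp (-2))) := by
      intro x hx
      refine ⟨hpos x hx, ?_⟩
      rw [Real.exp_neg]
      refine (le_inv_comm₀ (Real.exp_pos _) (hpos x hx)).1 ((Real.exp_le_exp.2 ?_).trans (hle x hx))
      exact hc.trans (Real.le_exp_iterate c k)
    have h := ih (f := fun x => (Real.log (f x)⁻¹)⁻¹)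
      (Real.concaveOn_inv_log_inv.comp_of_mapsTo hf Real.monotoneOn_inv_log_inv hmaps)
      (fun x hx => inv_pos.2 (by linarith [Real.log_inv_ge_two_of_mem (hmaps hx)]))
      (fun x hx => by
        rw [inv_inv]
        exact (Real.le_log_iff_exp_le (inv_pos.2 (hpos x hx))).2 (hle x hx))
    simpa only [inv_inv] using h


/-- For every integer `k ≥ 1`, every real `α` with `0 < α < 1`, and every
real `n ≥ 1`, the function `x ↦ 1 / (ln^[k] (n/x))^α` is concave on the interval
`(0, n / T_{k,α}]`, where `T_{k,α} = exp^[k]((4k)^{1/α})`. -/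
theorem iterated_log_reciprocal_concave (k : ℕ) (hk : 1 ≤ k) (α : ℝ) (hα0 : 0 < α)
    (hα1 : α < 1) (n : ℝ) (hn : 1 ≤ n) :
    ConcaveOn ℝ (Set.Ioc 0 (n / Real.exp^[k] (((4 * k : ℕ) : ℝ) ^ (1 / α))))
      (fun x : ℝ => 1 / (Real.log^[k] (n / x)) ^ α) := by
  have hk' : (4 : ℝ) ≤ ((4 * k : ℕ) : ℝ) := by exact_mod_cast (by omega : 4 ≤ 4 * k)
  have hc : (2 : ℝ) ≤ ((4 * k : ℕ) : ℝ) ^ (1 / α) := by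
    have := Real.self_le_rpow_of_one_le (by linarith : (1 : ℝ) ≤ ((4 * k : ℕ) : ℝ))
      ((one_le_div hα0).2 hα1.le)
    linarith
  have hn0 : 0 < n := by linarith
  set c := ((4 * k : ℕ) : ℝ) ^ (1 / α)
  have hT : 0 < Real.exp^[k] c := by linarith [Real.le_exp_iterate c k]
  have hlin : ConcaveOn ℝ (Set.Ioc 0 (n / Real.exp^[k] c)) (fun x => x / n) :=
    ⟨convex_Ioc _ _, fun x _ y _ a b _ _ _ => le_of_eq (by simp only [smul_eq_mul]; ring)⟩
  obtain ⟨hconc, hlog⟩ := hlin.inv_log_iterate_inv hc k (fun x hx => div_pos hx.1 hn0)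
    (fun x hx => by
      rw [inv_div, le_div_comm₀ hT hx.1]
      exact hx.2)
  simp only [inv_div] at hconc hlog
  refine ((Real.concaveOn_rpow hα0.le hα1.le).comp_of_mapsTo hconc
    (Real.monotoneOn_rpow_Ici_of_exponent_nonneg hα0.le)
    (fun x hx => Set.mem_Ici.2 (inv_nonneg.2 (by linarith [hlog x hx])))).congr ?_
  intro x hx
  simp only [one_div]
  exact Real.inv_rpow (by linarith [hlog x hx]) α
end

section
/- For the simple random walk on ℤ², the variance of the range satisfies Var(R^(n)) ≤ 6 (E[R^(n)])² + E[R^(n)] for every n ≥ 1. -/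
/-!
The simple random walk on `ℤ²`.  A path of length `n` is a function `Fin n → Fin 4`
choosing at each time one of the four unit steps, each path having probability `4⁻ⁿ`.
-/

/-- The four unit steps of the simple random walk on `ℤ²`. -/
def stepVec : Fin 4 → ℤ × ℤ := ![(1, 0), (-1, 0), (0, 1), (0, -1)]

/-- The position of the walk after `m` steps, along the path `ω`. -/
def pathPos {n : ℕ} (ω : Fin n → Fin 4) (m : ℕ) : ℤ × ℤ :=
  ∑ i ∈ Finset.univ.filter (fun i : Fin n => (i : ℕ) < m), stepVec (ω i)

/-- The range `R⁽ⁿ⁾`: the number of distinct points visited up to time `n`. -/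
def walkRange {n : ℕ} (ω : Fin n → Fin 4) : ℕ :=
  ((Finset.range (n + 1)).image (pathPos ω)).card

/-- Expectation of a functional of the simple random walk path of length `n`
(uniform measure on the `4 ^ n` paths). -/
noncomputable def expectSRW (n : ℕ) (g : (Fin n → Fin 4) → ℝ) : ℝ :=
  (∑ ω : Fin n → Fin 4, g ω) / 4 ^ n

/-- The path `ω` is at time `k` at a point it has not visited before. -/
def IsNewAt {n : ℕ} (ω : Fin n → Fin 4) (k : ℕ) : Prop :=
  ∀ i < k, pathPos ω i ≠ pathPos ω k

instance {n : ℕ} (ω : Fin n → Fin 4) (k : ℕ) : Decidable (IsNewAt ω k) :=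
  inferInstanceAs (Decidable (∀ i < k, pathPos ω i ≠ pathPos ω k))

/-- The number of paths of length `n` that are at a new point at time `k`. -/
def newCount (n k : ℕ) : ℕ :=
  (Finset.univ.filter (fun ω : Fin n → Fin 4 => IsNewAt ω k)).card

theorem card_image_range_eq_card_filter {α : Type*} [DecidableEq α] (f : ℕ → α) (m : ℕ) :
    ((Finset.range m).image f).card =
      ((Finset.range m).filter (fun k => ∀ i < k, f i ≠ f k)).card := by
  induction m with
  | zero => simp
  | succ m ih =>
    rw [Finset.range_add_one, Finset.image_insert, Finset.filter_insert]
    split_ifs with h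
    · rw [Finset.card_insert_of_notMem (by simpa using h), Finset.card_insert_of_notMem (by simp),
        ih]
    · rw [Finset.insert_eq_of_mem, ih]
      push Not at h
      simpa using h

theorem walkRange_eq_sum {n : ℕ} (ω : Fin n → Fin 4) :
    (walkRange ω : ℝ) = ∑ k ∈ Finset.range (n + 1), if IsNewAt ω k then 1 else 0 := by
  unfold walkRange
  rw [card_image_range_eq_card_filter, Finset.sum_boole]
  rfl

theorem pathPos_zero {n : ℕ} (ω : Fin n → Fin 4) : pathPos ω 0 = 0 := by
  simp [pathPos]

theorem pathPos_succ {n : ℕ} (ω : Fin n → Fin 4) {m : ℕ} (hm : m < n) :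
    pathPos ω (m + 1) = pathPos ω m + stepVec (ω ⟨m, hm⟩) := by
  unfold pathPos
  have : Finset.univ.filter (fun i : Fin n => (i : ℕ) < m + 1) =
      insert ⟨m, hm⟩ (Finset.univ.filter (fun i : Fin n => (i : ℕ) < m)) := by
    ext i
    simp [Fin.ext_iff]
    omega
  rw [this, Finset.sum_insert (by simp), add_comm]

theorem pathPos_eq_sub_of_shift {n : ℕ} {ω η : Fin n → Fin 4} {j l : ℕ} (hl : j + l ≤ n)
    (h : ∀ m (hm : j + m < n), m < l → η ⟨m, by omega⟩ = ω ⟨j + m, hm⟩) :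
    ∀ m ≤ l, pathPos η m = pathPos ω (j + m) - pathPos ω j := by
  intro m
  induction m with
  | zero => simp [pathPos_zero]
  | succ m ih =>
    intro hm
    rw [pathPos_succ η (by omega), ih (by omega), ← add_assoc,
      pathPos_succ ω (show j + m < n by omega), h m (by omega) (by omega)]
    abel

theorem IsNewAt.of_shift {n : ℕ} {ω η : Fin n → Fin 4} {j l : ℕ} (hl : j + l ≤ n)
    (h : ∀ m (hm : j + m < n), m < l → η ⟨m, by omega⟩ = ω ⟨j + m, hm⟩)
    (hω : IsNewAt ω (j + l)) : IsNewAt η l := by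
  intro i hi heq
  rw [pathPos_eq_sub_of_shift hl h i hi.le, pathPos_eq_sub_of_shift hl h l le_rfl] at heq
  exact hω (j + i) (by omega) (sub_left_injective heq)

theorem card_new_new_mul_le {n j k : ℕ} (hjk : j ≤ k) (hk : k ≤ n) :
    (Finset.univ.filter (fun ω : Fin n → Fin 4 => IsNewAt ω j ∧ IsNewAt ω k)).card * 4 ^ n
      ≤ newCount n j * newCount n (k - j) := by
  have huniv : 4 ^ n = (Finset.univ : Finset (Fin n → Fin 4)).card := by simp
  unfold newCount
  rw [huniv, ← Finset.card_product, ← Finset.card_product]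
  let F : (Fin n → Fin 4) × (Fin n → Fin 4) → (Fin n → Fin 4) × (Fin n → Fin 4) := fun p =>
    (fun i => if (i : ℕ) < j then p.1 i else p.2 i,
     fun i => if h : j + i < n then p.1 ⟨j + i, h⟩ else p.2 ⟨j + i - n, by omega⟩)
  refine Finset.card_le_card_of_injOn F ?_ ?_
  · rintro ⟨ω, η⟩ hp
    simp only [Finset.coe_product, Set.mem_prod, Finset.mem_coe, Finset.mem_filter,
      Finset.mem_univ, true_and, and_true] at hp ⊢
    constructor
    · refine IsNewAt.of_shift (ω := ω) (j := 0) (by omega) ?_ (by simpa using hp.1)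
      intro m _ hmj
      simp [F, hmj]
    · refine IsNewAt.of_shift (ω := ω) (j := j) (by omega) ?_
        (by simpa [Nat.add_sub_cancel' hjk] using hp.2)
      intro m hm _
      simp [F, hm]
  · rintro ⟨ω, η⟩ - ⟨ω', η'⟩ - heq
    obtain ⟨h₁, h₂⟩ := Prod.ext_iff.1 heq
    refine Prod.ext (funext fun i => ?_) (funext fun i => ?_)
    · by_cases hi : (i : ℕ) < j
      · simpa [F, hi] using congrFun h₁ i
      · have := congrFun h₂ ⟨i - j, by omega⟩
        simpa [F, Nat.add_sub_cancel' (not_lt.1 hi)] using this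
    · by_cases hi : (i : ℕ) < j
      · have := congrFun h₂ ⟨i + n - j, by omega⟩
        have e : j + (i + n - j) = i + n := by omega
        simpa [F, e] using this
      · simpa [F, hi] using congrFun h₁ i

theorem sum_walkRange (n : ℕ) :
    ∑ ω : Fin n → Fin 4, (walkRange ω : ℝ) =
      ∑ k ∈ Finset.range (n + 1), (newCount n k : ℝ) := by
  simp_rw [walkRange_eq_sum]
  rw [Finset.sum_comm]
  simp [newCount]

theorem sum_Ico_newCount_mul_le (n : ℕ) :
    ∑ j ∈ Finset.range (n + 1), ∑ k ∈ Finset.Ico j (n + 1),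
        (newCount n j : ℝ) * newCount n (k - j)
      ≤ (∑ k ∈ Finset.range (n + 1), (newCount n k : ℝ)) ^ 2 := by
  rw [sq, Finset.sum_mul]
  refine Finset.sum_le_sum fun j _ => ?_
  rw [← Finset.mul_sum, Finset.sum_Ico_eq_sum_range]
  simp only [Nat.add_sub_cancel_left]
  gcongr
  omega

theorem sum_walkRange_sq_mul_le (n : ℕ) :
    (∑ ω : Fin n → Fin 4, (walkRange ω : ℝ) ^ 2) * 4 ^ n
      ≤ 2 * (∑ ω : Fin n → Fin 4, (walkRange ω : ℝ)) ^ 2 := by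
  let a : (Fin n → Fin 4) → ℕ → ℝ := fun ω k => if IsNewAt ω k then 1 else 0
  have ha : ∀ ω k, 0 ≤ a ω k := fun ω k => by dsimp only [a]; split_ifs <;> norm_num
  have hpath (ω : Fin n → Fin 4) : (walkRange ω : ℝ) ^ 2 ≤
      2 * ∑ j ∈ Finset.range (n + 1), ∑ k ∈ Finset.Ico j (n + 1), a ω j * a ω k := by
    have hIco : ∀ j, Finset.Ico j (n + 1) = (Finset.range (n + 1)).filter (j ≤ ·) := by
      intro j; ext k; simp; omega
    have hle : ∑ j ∈ Finset.range (n + 1), ∑ k ∈ Finset.range (n + 1), a ω j * a ω k ≤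
        ∑ j ∈ Finset.range (n + 1), ∑ k ∈ Finset.range (n + 1),
          ((if j ≤ k then a ω j * a ω k else 0) + if k ≤ j then a ω k * a ω j else 0) := by
      refine Finset.sum_le_sum fun j _ => Finset.sum_le_sum fun k _ => ?_
      have := mul_nonneg (ha ω j) (ha ω k)
      rcases le_total j k with h | h
      · rw [if_pos h]
        split_ifs <;> linarith
      · rw [if_pos h]
        split_ifs <;> linarith
    rw [walkRange_eq_sum, sq, Finset.sum_mul_sum]
    refine hle.trans_eq ?_
    simp_rw [Finset.sum_add_distrib, hIco, Finset.sum_filter]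
    rw [two_mul]
    congr 1
    exact Finset.sum_comm
  have hpair : ∀ j k, j ≤ k → k ≤ n →
      (∑ ω, a ω j * a ω k) * 4 ^ n ≤ (newCount n j : ℝ) * newCount n (k - j) := by
    intro j k hjk hk
    have hcard : ∑ ω, a ω j * a ω k =
        (Finset.univ.filter (fun ω : Fin n → Fin 4 => IsNewAt ω j ∧ IsNewAt ω k)).card := by
      rw [← Finset.sum_boole]
      refine Finset.sum_congr rfl fun ω _ => ?_
      by_cases h₁ : IsNewAt ω j <;> by_cases h₂ : IsNewAt ω k <;> simp [a, h₁, h₂]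
    rw [hcard]
    exact_mod_cast card_new_new_mul_le hjk hk
  rw [sum_walkRange]
  calc (∑ ω : Fin n → Fin 4, (walkRange ω : ℝ) ^ 2) * 4 ^ n
      ≤ (∑ ω, 2 * ∑ j ∈ Finset.range (n + 1), ∑ k ∈ Finset.Ico j (n + 1),
          a ω j * a ω k) * 4 ^ n := by
        gcongr with ω
        exact hpath ω
    _ = 2 * ∑ j ∈ Finset.range (n + 1), ∑ k ∈ Finset.Ico j (n + 1),
          (∑ ω, a ω j * a ω k) * 4 ^ n := by
        rw [← Finset.mul_sum, Finset.sum_comm, mul_assoc, Finset.sum_mul]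
        congr 1
        refine Finset.sum_congr rfl fun j _ => ?_
        rw [Finset.sum_comm, Finset.sum_mul]
    _ ≤ 2 * ∑ j ∈ Finset.range (n + 1), ∑ k ∈ Finset.Ico j (n + 1),
          (newCount n j : ℝ) * newCount n (k - j) := by
        refine mul_le_mul_of_nonneg_left (Finset.sum_le_sum fun j _ => Finset.sum_le_sum
          fun k hk => ?_) zero_le_two
        rw [Finset.mem_Ico] at hk
        exact hpair j k hk.1 (by omega)
    _ ≤ _ := by
        gcongr
        exact sum_Ico_newCount_mul_le n

theorem expectSRW_sub_sq (n : ℕ) (g : (Fin n → Fin 4) → ℝ) :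
    expectSRW n (fun ω => (g ω - expectSRW n g) ^ 2) =
      expectSRW n (fun ω => g ω ^ 2) - expectSRW n g ^ 2 := by
  have hsum : ∑ ω, g ω = expectSRW n g * 4 ^ n := by
    unfold expectSRW
    field_simp
  have hcard : ((Finset.univ : Finset (Fin n → Fin 4)).card : ℝ) = 4 ^ n := by simp
  generalize expectSRW n g = c at hsum ⊢
  unfold expectSRW
  simp_rw [sub_sq, Finset.sum_add_distrib, Finset.sum_sub_distrib, ← Finset.sum_mul,
    ← Finset.mul_sum, Finset.sum_const, nsmul_eq_mul, hcard, hsum]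
  field_simp
  ring

/-- For the simple random walk on `ℤ²`, the variance of the range
satisfies `Var(R⁽ⁿ⁾) ≤ 6 (E[R⁽ⁿ⁾])² + E[R⁽ⁿ⁾]` for every `n ≥ 1`. -/
theorem variance_range_le (n : ℕ) (hn : 1 ≤ n) :
    expectSRW n (fun ω => ((walkRange ω : ℝ) -
        expectSRW n (fun ω' => (walkRange ω' : ℝ))) ^ 2)
      ≤ 6 * (expectSRW n (fun ω => (walkRange ω : ℝ))) ^ 2
          + expectSRW n (fun ω => (walkRange ω : ℝ)) := by
  rw [expectSRW_sub_sq]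
  have hsq : expectSRW n (fun ω => (walkRange ω : ℝ) ^ 2) ≤
      2 * expectSRW n (fun ω => (walkRange ω : ℝ)) ^ 2 := by
    unfold expectSRW
    rw [div_pow, ← mul_div_assoc, div_le_div_iff₀ (by positivity) (by positivity)]
    have := mul_le_mul_of_nonneg_right (sum_walkRange_sq_mul_le n)
      (show (0 : ℝ) ≤ 4 ^ n by positivity)
    linarith
  have hnonneg : 0 ≤ expectSRW n (fun ω => (walkRange ω : ℝ)) := by
    unfold expectSRW
    positivity
  nlinarith [sq_nonneg (expectSRW n (fun ω => (walkRange ω : ℝ)))]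
end

section
/- For the simple random walk on ℤ², there exist constants q₁ > 0 and q₂ > 0 such that for every n > 1, Pr[R^(n) ≥ q₁ · n / ln(n)] ≥ q₂. -/
open Classical in
/-- Probability of an event for the simple random walk path of length `n`
(uniform measure on the `4 ^ n` paths). -/
noncomputable def probSRW (n : ℕ) (p : (Fin n → Fin 4) → Prop) : ℝ :=
  ((Finset.univ.filter p).card : ℝ) / 4 ^ n

open Finset in
/-- Cauchy–Schwarz bound on the size of an image by the number of coincidences. -/
theorem card_sq_le_card_image_mul_card_coincidences {α β : Type*} [DecidableEq β]
    (s : Finset α) (f : α → β) :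
    #s ^ 2 ≤ #(s.image f) * #{p ∈ s ×ˢ s | f p.1 = f p.2} := by
  have h1 : #s = ∑ b ∈ s.image f, #{a ∈ s | f a = b} := card_eq_sum_card_image f s
  have h2 : #{p ∈ s ×ˢ s | f p.1 = f p.2} = ∑ b ∈ s.image f, #{a ∈ s | f a = b} ^ 2 := by
    rw [card_eq_sum_card_fiberwise (f := fun p => f p.1) (t := s.image f)]
    · refine sum_congr rfl fun b _ => ?_
      rw [sq, ← card_product]
      congr 1
      ext ⟨x, y⟩
      simp only [mem_filter, mem_product]
      constructor
      · rintro ⟨⟨⟨hx, hy⟩, hxy⟩, hb⟩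
        exact ⟨⟨hx, hb⟩, hy, hxy ▸ hb⟩
      · rintro ⟨⟨hx, hxb⟩, hy, hyb⟩
        exact ⟨⟨⟨hx, hy⟩, hxb.trans hyb.symm⟩, hxb⟩
    · intro p hp
      simp only [coe_filter, mem_product, Set.mem_ofPred_eq] at hp
      exact mem_image_of_mem f hp.1.1
  rw [h2]
  nth_rewrite 1 [h1]
  exact sq_sum_le_card_mul_sum_sq

theorem centralBinom_sq_mul_le (k : ℕ) : k.centralBinom ^ 2 * (2 * k + 1) ≤ 16 ^ k := by
  induction k with
  | zero => simp
  | succ k ih =>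
    have h := Nat.succ_mul_centralBinom_succ k
    refine Nat.le_of_mul_le_mul_left (c := (k + 1) ^ 2) ?_ (by positivity)
    calc (k + 1) ^ 2 * ((k + 1).centralBinom ^ 2 * (2 * (k + 1) + 1))
        = ((k + 1) * (k + 1).centralBinom) ^ 2 * (2 * k + 3) := by ring
      _ = (k.centralBinom ^ 2 * (2 * k + 1)) * (4 * (2 * k + 1) * (2 * k + 3)) := by
        rw [h]; ring
      _ ≤ 16 ^ k * (16 * (k + 1) ^ 2) := Nat.mul_le_mul ih (by nlinarith)
      _ = (k + 1) ^ 2 * 16 ^ (k + 1) := by ring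

open Finset in
/-- Few subsets of a finite type meet a given set `I` in exactly half of its elements. -/
theorem card_halving_sq_mul_le {n : ℕ} (I : Finset (Fin n)) :
    #{A : Finset (Fin n) | 2 * #(A ∩ I) = #I} ^ 2 * (#I + 1) ≤ 4 ^ n := by
  rcases Nat.even_or_odd' #I with ⟨k, hk | hk⟩
  · have hle : 2 * k ≤ n := by simpa [hk] using card_le_univ I
    have h : #{A : Finset (Fin n) | 2 * #(A ∩ I) = #I} ≤ k.centralBinom * 2 ^ (n - 2 * k) := by
      have hcard : #(powersetCard k I ×ˢ powerset Iᶜ) = k.centralBinom * 2 ^ (n - 2 * k) := by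
        rw [card_product, card_powersetCard, card_powerset, card_compl, hk, Fintype.card_fin]
        rfl
      rw [← hcard]
      refine card_le_card_of_injOn (fun A => (A ∩ I, A \ I)) ?_ ?_
      · intro A hA
        simp only [coe_filter, mem_univ, true_and, Set.mem_ofPred_eq] at hA
        simp only [coe_product, Set.mem_prod, mem_coe, mem_powersetCard, mem_powerset]
        refine ⟨⟨inter_subset_right, by omega⟩, fun x hx => ?_⟩
        simpa using (mem_sdiff.1 hx).2
      · intro A _ B _ hAB
        simp only [Prod.mk.injEq] at hAB
        rw [← sdiff_union_inter A I, ← sdiff_union_inter B I, hAB.1, hAB.2]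
    calc _ ≤ (k.centralBinom * 2 ^ (n - 2 * k)) ^ 2 * (2 * k + 1) := by
          rw [hk] at h ⊢; gcongr
      _ = (k.centralBinom ^ 2 * (2 * k + 1)) * 4 ^ (n - 2 * k) := by
        rw [mul_pow, ← pow_mul, mul_comm (n - 2 * k) 2, pow_mul]; ring
      _ ≤ 16 ^ k * 4 ^ (n - 2 * k) := Nat.mul_le_mul_right _ (centralBinom_sq_mul_le k)
      _ = 4 ^ (2 * k + (n - 2 * k)) := by rw [pow_add, pow_mul]; norm_num
      _ = 4 ^ n := by rw [Nat.add_sub_cancel' hle]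
  · have h : #{A : Finset (Fin n) | 2 * #(A ∩ I) = #I} = 0 := by
      rw [card_eq_zero, filter_eq_empty_iff]
      intro A _
      omega
    simp [h]

open Finset in
theorem two_mul_card_inter_eq_of_sum_sign_eq_zero {ι : Type*} [DecidableEq ι] (A I : Finset ι)
    (h : ∑ i ∈ I, (if i ∈ A then (1 : ℤ) else -1) = 0) : 2 * #(A ∩ I) = #I := by
  rw [sum_ite, filter_mem_eq_inter, filter_notMem_eq_sdiff] at h
  have := card_sdiff_add_card_inter I A
  rw [inter_comm A I]
  simp only [sum_const, nsmul_eq_mul, mul_one, mul_neg] at h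
  omega

open Finset in
/-- The probability that the steps indexed by `I` sum to zero is at most `1 / (#I + 1)`. -/
theorem card_sum_stepVec_eq_zero_mul_le {n : ℕ} (I : Finset (Fin n)) :
    #{ω : Fin n → Fin 4 | ∑ i ∈ I, stepVec (ω i) = 0} * (#I + 1) ≤ 4 ^ n := by
  refine le_trans (Nat.mul_le_mul_right _ ?_) (card_halving_sq_mul_le I)
  rw [sq, ← card_product]
  let u : (Fin n → Fin 4) → Finset (Fin n) := fun ω => {i | ω i = 0 ∨ ω i = 2}
  let v : (Fin n → Fin 4) → Finset (Fin n) := fun ω => {i | ω i = 0 ∨ ω i = 3}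
  refine card_le_card_of_injOn (fun ω => (u ω, v ω)) ?_ ?_
  · intro ω hω
    simp only [coe_filter, mem_univ, true_and, Set.mem_ofPred_eq] at hω
    have hu (a : Fin 4) : (if a = 0 ∨ a = 2 then (1 : ℤ) else -1) =
        (stepVec a).1 + (stepVec a).2 := by revert a; decide
    have hv (a : Fin 4) : (if a = 0 ∨ a = 3 then (1 : ℤ) else -1) =
        (stepVec a).1 - (stepVec a).2 := by revert a; decide
    have h1 := congrArg Prod.fst hω
    have h2 := congrArg Prod.snd hω
    rw [Prod.fst_sum] at h1
    rw [Prod.snd_sum] at h2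
    simp only [Prod.fst_zero, Prod.snd_zero] at h1 h2
    simp only [coe_product, Set.mem_prod, mem_coe, mem_filter, mem_univ, true_and]
    constructor <;> apply two_mul_card_inter_eq_of_sum_sign_eq_zero
    · simp only [u, mem_filter, mem_univ, true_and, hu, sum_add_distrib, h1, h2, add_zero]
    · simp only [v, mem_filter, mem_univ, true_and, hv, sum_sub_distrib, h1, h2, sub_zero]
  · intro ω _ ω' _ h
    simp only [Prod.mk.injEq, u, v, Finset.ext_iff, mem_filter, mem_univ, true_and] at h
    have key (a b : Fin 4) : (a = 0 ∨ a = 2 ↔ b = 0 ∨ b = 2) →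
        (a = 0 ∨ a = 3 ↔ b = 0 ∨ b = 3) → a = b := by revert a b; decide
    exact funext fun i => key _ _ (h.1 i) (h.2 i)

open Finset in
theorem card_pathPos_eq_mul_le_of_le {n i j : ℕ} (hij : i ≤ j) (hj : j ≤ n) :
    #{ω : Fin n → Fin 4 | pathPos ω i = pathPos ω j} * (j - i + 1) ≤ 4 ^ n := by
  let I : Finset (Fin n) := {k | (k : ℕ) < j ∧ ¬ (k : ℕ) < i}
  have hI : #I = j - i := by
    rw [← Nat.card_Ico, ← card_map Fin.valEmbedding]
    congr 1
    ext x
    simp only [I, mem_map, mem_filter, mem_univ, true_and, Fin.valEmbedding_apply, mem_Ico]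
    constructor
    · rintro ⟨k, hk, rfl⟩
      omega
    · exact fun hx => ⟨⟨x, by omega⟩, by simp only; omega, rfl⟩
  have h := card_sum_stepVec_eq_zero_mul_le I
  rw [hI] at h
  refine le_trans (Nat.mul_le_mul_right _ (card_le_card ?_)) h
  intro ω
  simp only [mem_filter, mem_univ, true_and]
  intro hω
  have hsum : pathPos ω j = pathPos ω i + ∑ k ∈ I, stepVec (ω k) := by
    unfold pathPos
    rw [← sum_filter_add_sum_filter_not (univ.filter fun k : Fin n => (k : ℕ) < j)
      (fun k => (k : ℕ) < i), filter_filter, filter_filter]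
    congr 2
    ext k
    simp only [mem_filter, mem_univ, true_and]
    omega
  rw [hω] at hsum
  simpa using hsum

open Finset in
theorem card_pathPos_eq_le {n i j : ℕ} (hi : i ≤ n) (hj : j ≤ n) :
    (#{ω : Fin n → Fin 4 | pathPos ω i = pathPos ω j} : ℝ) ≤
      4 ^ n * (((Nat.dist i j + 1 : ℕ) : ℝ))⁻¹ := by
  rw [← div_eq_mul_inv, le_div_iff₀ (by positivity)]
  rcases le_total i j with h | h
  · rw [Nat.dist_eq_sub_of_le h]
    exact_mod_cast card_pathPos_eq_mul_le_of_le h hj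
  · rw [Nat.dist_eq_sub_of_le_right h]
    simp_rw [eq_comm (a := pathPos _ i)]
    exact_mod_cast card_pathPos_eq_mul_le_of_le h hi

open Finset in
theorem sum_range_dist_le (f : ℕ → ℝ) (hf : ∀ k, 0 ≤ f k) {N i : ℕ} (hi : i < N) :
    ∑ j ∈ range N, f (Nat.dist i j) ≤ 2 * ∑ k ∈ range N, f k := by
  have key (s : Finset ℕ) (hs : ∀ j ∈ s, j < N) (hinj : Set.InjOn (Nat.dist i) s) :
      ∑ j ∈ s, f (Nat.dist i j) ≤ ∑ k ∈ range N, f k := by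
    rw [← sum_image (f := f) hinj]
    refine sum_le_sum_of_subset_of_nonneg ?_ fun k _ _ => hf k
    intro k hk
    obtain ⟨j, hj, rfl⟩ := mem_image.1 hk
    have := hs j hj
    rw [mem_range, Nat.dist]
    omega
  rw [← sum_filter_add_sum_filter_not _ (fun j => j < i), two_mul]
  refine add_le_add (key _ ?_ ?_) (key _ ?_ ?_)
  · simp +contextual
  · intro a ha b hb hab
    simp only [coe_filter, mem_range, Set.mem_ofPred_eq, Nat.dist] at ha hb hab
    omega
  · simp +contextual
  · intro a ha b hb hab
    simp only [coe_filter, mem_range, Set.mem_ofPred_eq, Nat.dist] at ha hb hab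
    omega

theorem sum_range_inv_le_four_mul_log {n : ℕ} (hn : 1 < n) :
    ∑ k ∈ Finset.range (n + 1), ((k + 1 : ℕ) : ℝ)⁻¹ ≤ 4 * Real.log n := by
  have h := harmonic_le_one_add_log (n + 1)
  simp only [harmonic, Rat.cast_sum, Rat.cast_inv, Rat.cast_natCast] at h
  have hn2 : (2 : ℝ) ≤ n := by exact_mod_cast hn
  have h2 : Real.log 2 ≤ Real.log n := Real.log_le_log (by norm_num) hn2
  have h3 : Real.log ((n + 1 : ℕ) : ℝ) ≤ 2 * Real.log n := by
    rw [show 2 * Real.log n = Real.log ((n : ℝ) ^ 2) by rw [Real.log_pow]; norm_num]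
    refine Real.log_le_log (by positivity) ?_
    push_cast
    nlinarith
  have := Real.log_two_gt_d9
  linarith

open Finset in
/-- The expected number of pairs of times at which the walk is at the same place is
`O(n log n)`. -/
theorem sum_card_coincidences_le {n : ℕ} (hn : 1 < n) :
    ∑ ω : Fin n → Fin 4, (#{p ∈ range (n + 1) ×ˢ range (n + 1) |
      pathPos ω p.1 = pathPos ω p.2} : ℝ) ≤ 4 ^ n * (8 * (n + 1) * Real.log n) := by
  calc ∑ ω : Fin n → Fin 4, (#{p ∈ range (n + 1) ×ˢ range (n + 1) |
      pathPos ω p.1 = pathPos ω p.2} : ℝ)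
      = ∑ p ∈ range (n + 1) ×ˢ range (n + 1),
          (#{ω : Fin n → Fin 4 | pathPos ω p.1 = pathPos ω p.2} : ℝ) := by
        simp_rw [card_filter, Nat.cast_sum]
        exact sum_comm
    _ ≤ ∑ p ∈ range (n + 1) ×ˢ range (n + 1), 4 ^ n * ((Nat.dist p.1 p.2 + 1 : ℕ) : ℝ)⁻¹ := by
        refine sum_le_sum fun p hp => ?_
        simp only [mem_product, mem_range, Nat.lt_succ_iff] at hp
        exact card_pathPos_eq_le hp.1 hp.2
    _ = 4 ^ n * ∑ i ∈ range (n + 1), ∑ j ∈ range (n + 1), ((Nat.dist i j + 1 : ℕ) : ℝ)⁻¹ := by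
        rw [← mul_sum, sum_product]
    _ ≤ 4 ^ n * ∑ i ∈ range (n + 1), 2 * (4 * Real.log n) := by
        gcongr with i hi
        refine (sum_range_dist_le (fun k => ((k + 1 : ℕ) : ℝ)⁻¹) (fun k => by positivity)
          (mem_range.1 hi)).trans ?_
        gcongr
        exact sum_range_inv_le_four_mul_log hn
    _ = 4 ^ n * (8 * (n + 1) * Real.log n) := by
        rw [sum_const, card_range, nsmul_eq_mul]
        push_cast
        ring

/-- For the simple random walk on `ℤ²`, there exist constants
`q₁ > 0` and `q₂ > 0` such that for every `n > 1`,
`Pr[R⁽ⁿ⁾ ≥ q₁ · n / ln n] ≥ q₂`. -/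
theorem range_prob_lower : ∃ q₁ > (0 : ℝ), ∃ q₂ > (0 : ℝ), ∀ n : ℕ, 1 < n →
    q₂ ≤ probSRW n (fun ω => q₁ * n / Real.log n ≤ (walkRange ω : ℝ)) := by
  classical
  refine ⟨1 / 16, by norm_num, 1 / 2, by norm_num, fun n hn => ?_⟩
  have hlog : 0 < Real.log n := Real.log_pos (by exact_mod_cast hn)
  let Q : (Fin n → Fin 4) → ℕ := fun ω =>
    ((Finset.range (n + 1) ×ˢ Finset.range (n + 1)).filter
      fun p => pathPos ω p.1 = pathPos ω p.2).card
  have hCS (ω : Fin n → Fin 4) : ((n : ℝ) + 1) ^ 2 ≤ walkRange ω * Q ω := by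
    have h := card_sq_le_card_image_mul_card_coincidences (Finset.range (n + 1)) (pathPos ω)
    rw [Finset.card_range] at h
    exact_mod_cast h
  set good := Finset.univ.filter fun ω : Fin n → Fin 4 =>
    1 / 16 * n / Real.log n ≤ (walkRange ω : ℝ) with hgood
  have hbad (ω : Fin n → Fin 4) (hω : ω ∈ goodᶜ) : 16 * (n + 1) * Real.log n ≤ Q ω := by
    simp only [hgood, Finset.mem_compl, Finset.mem_filter, Finset.mem_univ, true_and, not_le] at hω
    rw [lt_div_iff₀ hlog] at hω
    by_contra! hQ
    have h1 : (walkRange ω : ℝ) * Q ω ≤ walkRange ω * (16 * (n + 1) * Real.log n) := by gcongr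
    have h2 := hCS ω
    nlinarith
  have hmarkov : (goodᶜ.card : ℝ) * (16 * (n + 1) * Real.log n) ≤
      4 ^ n * (8 * (n + 1) * Real.log n) := by
    rw [← nsmul_eq_mul]
    refine (Finset.card_nsmul_le_sum _ (fun ω => (Q ω : ℝ)) _ hbad).trans ?_
    refine le_trans ?_ (sum_card_coincidences_le hn)
    exact Finset.sum_le_sum_of_subset_of_nonneg (Finset.subset_univ _) fun _ _ _ => by positivity
  have hpos : 0 < 8 * ((n : ℝ) + 1) * Real.log n := by positivity
  have hhalf : (goodᶜ.card : ℝ) * 2 ≤ 4 ^ n := by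
    refine le_of_mul_le_mul_right ?_ hpos
    linarith
  have htotal : (good.card : ℝ) + goodᶜ.card = 4 ^ n := by
    have h := Finset.card_add_card_compl good
    rw [Fintype.card_fun, Fintype.card_fin, Fintype.card_fin] at h
    exact_mod_cast h
  have hprob : probSRW n (fun ω => 1 / 16 * n / Real.log n ≤ (walkRange ω : ℝ)) =
      (good.card : ℝ) / 4 ^ n := by
    unfold probSRW
    congr
  rw [hprob, le_div_iff₀ (by positivity)]
  linarith
end

section
/- Let f : [0,∞) → [0,∞) be a strictly increasing function with f(0) = 0 such that f(C·x) ≤ C·f(x) for every C > 1 and x ≥ 0. Then for the simple random walk on ℤ² there exist ε > 0 and N such that for all n ≥ N, E[ Σ_{z ∈ ℤ²} f(b_z^(n)) ] ≥ ε · f(ln(n)) · n / ln(n). -/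
/-- The local time `b_z⁽ⁿ⁾`: the number of visits to `z` up to time `n`. -/
def localTime {n : ℕ} (ω : Fin n → Fin 4) (z : ℤ × ℤ) : ℕ :=
  ((Finset.range (n + 1)).filter (fun m => pathPos ω m = z)).card

open Finset

theorem Nat.two_mul_add_one_mul_centralBinom_sq_le (m : ℕ) :
    (2 * m + 1) * m.centralBinom ^ 2 ≤ 16 ^ m := by
  induction m with
  | zero => simp
  | succ m ih =>
    have h := Nat.succ_mul_centralBinom_succ m
    have hpos : 0 < (m + 1) ^ 2 := by positivity
    refine Nat.le_of_mul_le_mul_left ?_ hpos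
    calc (m + 1) ^ 2 * ((2 * (m + 1) + 1) * (m + 1).centralBinom ^ 2)
        = (2 * m + 3) * ((m + 1) * (m + 1).centralBinom) ^ 2 := by ring
      _ = 4 * ((2 * m + 3) * (2 * m + 1)) * ((2 * m + 1) * m.centralBinom ^ 2) := by
        rw [h]; ring
      _ ≤ 4 * (4 * (m + 1) ^ 2) * 16 ^ m :=
        Nat.mul_le_mul (Nat.mul_le_mul_left _ (by nlinarith)) ih
      _ = (m + 1) ^ 2 * 16 ^ (m + 1) := by ring

/-- The number of subsets meeting `A` in exactly half of its points. -/
theorem card_filter_two_mul_card_inter_le {ι : Type*} [Fintype ι] [DecidableEq ι]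
    (A : Finset ι) :
    (#A + 1) * #{T : Finset ι | 2 * #(T ∩ A) = #A} ^ 2 ≤ 4 ^ Fintype.card ι := by
  by_cases hA : ∃ m, #A = 2 * m
  · obtain ⟨m, hm⟩ := hA
    have hcard : #{T : Finset ι | 2 * #(T ∩ A) = #A} ≤ m.centralBinom * 2 ^ #Aᶜ := by
      rw [Nat.centralBinom_eq_two_mul_choose, ← hm, ← card_powersetCard, ← card_powerset,
        ← card_product]
      refine card_le_card_of_injOn (fun T => (T ∩ A, T ∩ Aᶜ)) ?_ ?_
      · intro T hT
        have hT' : 2 * #(T ∩ A) = #A := by simpa using hT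
        have : #(T ∩ A) = m := by omega
        simp [mem_powersetCard, this]
      · intro T _ U _ h
        simp only [Prod.mk.injEq] at h
        ext x
        have h1 := congrArg (x ∈ ·) h.1
        have h2 := congrArg (x ∈ ·) h.2
        simp only [mem_inter, mem_compl, eq_iff_iff] at h1 h2
        tauto
    calc (#A + 1) * #{T : Finset ι | 2 * #(T ∩ A) = #A} ^ 2
        ≤ (2 * m + 1) * (m.centralBinom * 2 ^ #Aᶜ) ^ 2 := by rw [hm] at hcard ⊢; gcongr
      _ = ((2 * m + 1) * m.centralBinom ^ 2) * 4 ^ #Aᶜ := by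
        rw [mul_pow, ← pow_mul, mul_comm _ 2, pow_mul]; norm_num; ring
      _ ≤ 16 ^ m * 4 ^ #Aᶜ := by gcongr; exact Nat.two_mul_add_one_mul_centralBinom_sq_le m
      _ = 4 ^ Fintype.card ι := by
        rw [← card_add_card_compl A, hm, pow_add, pow_mul]; norm_num
  · have : #{T : Finset ι | 2 * #(T ∩ A) = #A} = 0 := by
      rw [card_eq_zero, filter_eq_empty_iff]
      exact fun T _ h => hA ⟨_, h.symm⟩
    simp [this]

theorem stepVec_fst_add_snd (a : Fin 4) :
    (stepVec a).1 + (stepVec a).2 = 2 * (if a = 0 ∨ a = 2 then 1 else 0) - 1 := by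
  fin_cases a <;> simp [stepVec]

theorem stepVec_fst_sub_snd (a : Fin 4) :
    (stepVec a).1 - (stepVec a).2 = 2 * (if a = 0 ∨ a = 3 then 1 else 0) - 1 := by
  fin_cases a <;> simp [stepVec]

theorem two_mul_card_filter_inter_eq {ι : Type*} [Fintype ι] [DecidableEq ι] (A : Finset ι)
    (p : ι → Prop) [DecidablePred p]
    (h : ∑ l ∈ A, (2 * (if p l then 1 else 0) - 1 : ℤ) = 0) :
    2 * #(univ.filter p ∩ A) = #A := by
  have hfilter : univ.filter p ∩ A = A.filter fun l => p l := by
    ext; simp [and_comm]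
  rw [sum_sub_distrib, ← mul_sum, sum_boole] at h
  simp only [sum_const, nsmul_eq_mul, mul_one] at h
  rw [hfilter]
  omega

/-- The number of paths whose steps with indices in `A` sum to zero. -/
theorem card_filter_sum_stepVec_eq_zero_le {n : ℕ} (A : Finset (Fin n)) :
    (#A + 1) * #{ω : Fin n → Fin 4 | ∑ l ∈ A, stepVec (ω l) = 0} ≤ 4 ^ n := by
  have hcard : #{ω : Fin n → Fin 4 | ∑ l ∈ A, stepVec (ω l) = 0}
      ≤ #{T : Finset (Fin n) | 2 * #(T ∩ A) = #A} ^ 2 := by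
    rw [sq, ← card_product]
    refine card_le_card_of_injOn
      (fun ω => (({l | ω l = 0 ∨ ω l = 2} : Finset (Fin n)),
        ({l | ω l = 0 ∨ ω l = 3} : Finset (Fin n)))) ?_ ?_
    · intro ω hω
      have h0 : ∑ l ∈ A, stepVec (ω l) = 0 := by simpa using hω
      have h1 : ∑ l ∈ A, (stepVec (ω l)).1 = 0 := by rw [← Prod.fst_sum, h0]; rfl
      have h2 : ∑ l ∈ A, (stepVec (ω l)).2 = 0 := by rw [← Prod.snd_sum, h0]; rfl
      simp only [coe_product, Set.mem_prod, mem_coe, mem_filter, mem_univ, true_and]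
      constructor
      · apply two_mul_card_filter_inter_eq
        simp only [← stepVec_fst_add_snd, sum_add_distrib, h1, h2, add_zero]
      · apply two_mul_card_filter_inter_eq
        simp only [← stepVec_fst_sub_snd, sum_sub_distrib, h1, h2, sub_zero]
    · intro ω _ η _ h
      simp only [Prod.mk.injEq] at h
      funext l
      have h1 := congrArg (l ∈ ·) h.1
      have h2 := congrArg (l ∈ ·) h.2
      simp only [mem_filter, mem_univ, true_and, eq_iff_iff] at h1 h2
      generalize ω l = a at h1 h2 ⊢
      generalize η l = b at h1 h2 ⊢
      revert a b
      decide
  calc _ ≤ _ := Nat.mul_le_mul_left _ hcard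
    _ ≤ _ := by simpa using card_filter_two_mul_card_inter_le A

theorem pathPos_sub_pathPos {n : ℕ} (ω : Fin n → Fin 4) {i j : ℕ} (hij : i ≤ j) :
    pathPos ω j - pathPos ω i
      = ∑ l ∈ univ.filter (fun l : Fin n => i ≤ (l : ℕ) ∧ (l : ℕ) < j), stepVec (ω l) := by
  rw [sub_eq_iff_eq_add, pathPos, pathPos, ← sum_union]
  · congr 1
    ext l
    simp only [mem_union, mem_filter, mem_univ, true_and]
    omega
  · rw [disjoint_filter]
    intro l _ h
    omega

theorem card_filter_pathPos_eq_le {n i j : ℕ} (hij : i ≤ j) (hj : j ≤ n) :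
    (#{ω : Fin n → Fin 4 | pathPos ω i = pathPos ω j} : ℝ) ≤ 4 ^ n * ((j - i : ℕ) + 1 : ℝ)⁻¹ := by
  set A : Finset (Fin n) := univ.filter (fun l : Fin n => i ≤ (l : ℕ) ∧ (l : ℕ) < j) with hA
  have hcardA : #A = j - i := by
    rw [← Nat.card_Ico, ← card_map Fin.valEmbedding]
    congr 1
    ext x
    simp only [hA, mem_map, mem_filter, mem_univ, true_and, Fin.valEmbedding_apply, mem_Ico]
    constructor
    · rintro ⟨l, hl, rfl⟩
      exact hl
    · exact fun hx => ⟨⟨x, by omega⟩, hx, rfl⟩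
  have h := card_filter_sum_stepVec_eq_zero_le A
  have hset : (univ.filter fun ω : Fin n → Fin 4 => ∑ l ∈ A, stepVec (ω l) = 0)
      = univ.filter fun ω : Fin n → Fin 4 => pathPos ω i = pathPos ω j := by
    ext ω
    simp only [mem_filter, mem_univ, true_and]
    rw [hA, ← pathPos_sub_pathPos ω hij, sub_eq_zero, eq_comm]
  rw [hset, hcardA] at h
  rw [← div_eq_mul_inv, le_div_iff₀ (by positivity), mul_comm]
  exact_mod_cast h

theorem sum_card_filter_pathPos_eq_le {n i : ℕ} (hi : i ≤ n) :
    ∑ j ∈ range (n + 1), (#{ω : Fin n → Fin 4 | pathPos ω i = pathPos ω j} : ℝ)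
      ≤ 4 ^ n * (2 * (1 + Real.log (n + 1))) := by
  have hharm : ∑ k ∈ range (n + 1), ((k : ℝ) + 1)⁻¹ ≤ 1 + Real.log (n + 1) := by
    have h := harmonic_le_one_add_log (n + 1)
    simpa [harmonic] using h
  have hsub : ∀ m ≤ n + 1, ∑ k ∈ range m, ((k : ℝ) + 1)⁻¹ ≤ 1 + Real.log (n + 1) :=
    fun m hm => (sum_le_sum_of_subset_of_nonneg (range_subset_range.2 hm)
      fun _ _ _ => by positivity).trans hharm
  have hsplit : n + 1 = (i + 1) + (n - i) := by omega
  rw [hsplit, sum_range_add, two_mul, mul_add]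
  refine add_le_add ?_ ?_
  · rw [← sum_range_reflect]
    refine le_trans (sum_le_sum (g := fun k : ℕ => (4 : ℝ) ^ n * ((k : ℝ) + 1)⁻¹) ?_) ?_
    · intro k hk
      have hk' := mem_range.1 hk
      have h := card_filter_pathPos_eq_le (n := n) (i := i + 1 - 1 - k) (j := i) (by omega) hi
      rw [show i - (i + 1 - 1 - k) = k by omega] at h
      simpa only [eq_comm] using h
    · rw [← mul_sum]
      exact mul_le_mul_of_nonneg_left (hsub _ (by omega)) (by positivity)
  · refine le_trans (sum_le_sum (g := fun k : ℕ => (4 : ℝ) ^ n * ((k : ℝ) + 1)⁻¹) ?_) ?_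
    · intro k hk
      have hk' := mem_range.1 hk
      have h := card_filter_pathPos_eq_le (n := n) (i := i) (j := i + 1 + k) (by omega) (by omega)
      refine h.trans ?_
      gcongr
      omega
    · rw [← mul_sum]
      exact mul_le_mul_of_nonneg_left (hsub _ (by omega)) (by positivity)

/-- The finite set of sites visited by the path. -/
def visitedSites {n : ℕ} (ω : Fin n → Fin 4) : Finset (ℤ × ℤ) :=
  (range (n + 1)).image (pathPos ω)

theorem localTime_eq_zero {n : ℕ} {ω : Fin n → Fin 4} {z : ℤ × ℤ} (hz : z ∉ visitedSites ω) :
    localTime ω z = 0 := by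
  rw [localTime, card_eq_zero, filter_eq_empty_iff]
  exact fun m hm h => hz (mem_image.2 ⟨m, hm, h⟩)

theorem sum_localTime {n : ℕ} (ω : Fin n → Fin 4) :
    ∑ z ∈ visitedSites ω, localTime ω z = n + 1 := by
  simpa [localTime] using (card_eq_sum_card_fiberwise (s := range (n + 1)) (f := pathPos ω)
    (t := visitedSites ω) (fun m hm => mem_image_of_mem _ hm)).symm

theorem sum_localTime_sq {n : ℕ} (ω : Fin n → Fin 4) :
    ∑ z ∈ visitedSites ω, localTime ω z ^ 2
      = ∑ i ∈ range (n + 1), ∑ j ∈ range (n + 1), if pathPos ω i = pathPos ω j then 1 else 0 := by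
  have hinner : ∀ i, (∑ j ∈ range (n + 1), if pathPos ω i = pathPos ω j then 1 else 0)
      = localTime ω (pathPos ω i) := by
    intro i
    rw [localTime, sum_boole]
    simp only [eq_comm, Nat.cast_id]
  simp only [hinner]
  rw [← sum_fiberwise_of_maps_to (s := range (n + 1)) (t := visitedSites ω) (g := pathPos ω)
    (fun m hm => mem_image_of_mem _ hm)]
  refine sum_congr rfl fun z _ => ?_
  rw [sum_congr rfl (g := fun _ => localTime ω z) fun i hi => by rw [(mem_filter.1 hi).2],
    sum_const, smul_eq_mul, sq]
  rfl

theorem sum_paths_sum_localTime_sq_le (n : ℕ) :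
    ∑ ω : Fin n → Fin 4, ∑ z ∈ visitedSites ω, (localTime ω z : ℝ) ^ 2
      ≤ 4 ^ n * ((n + 1) * (2 * (1 + Real.log (n + 1)))) := by
  have hsq : ∀ ω : Fin n → Fin 4, ∑ z ∈ visitedSites ω, (localTime ω z : ℝ) ^ 2
      = ∑ i ∈ range (n + 1), ∑ j ∈ range (n + 1),
        if pathPos ω i = pathPos ω j then (1 : ℝ) else 0 :=
    fun ω => by exact_mod_cast sum_localTime_sq ω
  simp only [hsq]
  rw [sum_comm]
  refine (sum_le_card_nsmul _ _ (4 ^ n * (2 * (1 + Real.log (n + 1)))) fun i hi => ?_).trans_eq ?_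
  · rw [sum_comm]
    simp only [sum_boole]
    exact sum_card_filter_pathPos_eq_le (Nat.lt_succ_iff.1 (mem_range.1 hi))
  · rw [card_range, nsmul_eq_mul]
    push_cast
    ring

/-- A quadratic minorant for a monotone function of at most linear growth. -/
theorem mul_sub_sq_le_of_monotoneOn {f : ℝ → ℝ} (hmono : MonotoneOn f (Set.Ici 0))
    (hnonneg : ∀ x ∈ Set.Ici (0 : ℝ), 0 ≤ f x)
    (hhom : ∀ C : ℝ, 1 < C → ∀ x : ℝ, 0 ≤ x → f (C * x) ≤ C * f x)
    {L b : ℝ} (hL : 0 < L) (hb : 0 ≤ b) :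
    f L / (3 * L) * (b - b ^ 2 / (12 * L)) ≤ f b := by
  have hfL := hnonneg L hL.le
  have hfb := hnonneg b hb
  rcases le_or_gt L b with h | h
  · refine le_trans ?_ (hmono (Set.mem_Ici.2 hL.le) hb h)
    have hquad : b - b ^ 2 / (12 * L) ≤ 3 * L := by
      rw [sub_le_iff_le_add, ← sub_le_iff_le_add', le_div_iff₀ (by positivity)]
      nlinarith [sq_nonneg (b - 6 * L)]
    calc _ ≤ f L / (3 * L) * (3 * L) := by gcongr
      _ = f L := by field_simp
  · rcases hb.eq_or_lt with rfl | hb'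
    · simpa using hfb
    · have hscale := hhom (L / b) ((one_lt_div hb').2 h) b hb
      rw [div_mul_cancel₀ _ hb'.ne', div_mul_eq_mul_div, le_div_iff₀ hb'] at hscale
      calc _ ≤ f L / (3 * L) * b := by
            gcongr
            linarith [show 0 ≤ b ^ 2 / (12 * L) by positivity]
        _ = (f L * b) / (3 * L) := by ring
        _ ≤ f b := by
            rw [div_le_iff₀ (by positivity)]
            nlinarith [mul_nonneg hL.le hfb]

/-- Let `f : [0,∞) → [0,∞)` be a strictly increasing function with
`f(0) = 0` such that `f(C·x) ≤ C·f(x)` for every `C > 1` and `x ≥ 0`.  Then for the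
simple random walk on `ℤ²` there exist `ε > 0` and `N` such that for all `n ≥ N`,
`E[Σ_{z ∈ ℤ²} f(b_z⁽ⁿ⁾)] ≥ ε · f(ln n) · n / ln n`. -/
theorem expected_local_time_functional_lower (f : ℝ → ℝ)
    (hmono : StrictMonoOn f (Set.Ici 0))
    (hnonneg : ∀ x ∈ Set.Ici (0 : ℝ), 0 ≤ f x)
    (hf0 : f 0 = 0)
    (hhom : ∀ C : ℝ, 1 < C → ∀ x : ℝ, 0 ≤ x → f (C * x) ≤ C * f x) :
    ∃ ε > (0 : ℝ), ∃ N : ℕ, ∀ n : ℕ, N ≤ n →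
      ε * f (Real.log n) * n / Real.log n
        ≤ expectSRW n (fun ω => ∑' z : ℤ × ℤ, f (localTime ω z)) := by
  refine ⟨1 / 6, by norm_num, 3, fun n hn => ?_⟩
  have hn' : (3 : ℝ) ≤ n := by exact_mod_cast hn
  set L := Real.log n with hLdef
  have hL1 : 1 ≤ L := by
    rw [hLdef, Real.le_log_iff_exp_le (by linarith)]
    linarith [Real.exp_one_lt_d9]
  have hL : 0 < L := by linarith
  have hlog : Real.log (n + 1) ≤ 2 * L := by
    have h : Real.log (n + 1) ≤ Real.log ((n : ℝ) ^ 2) :=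
      Real.log_le_log (by positivity) (by nlinarith)
    simpa [Real.log_pow] using h
  have hfL := hnonneg L hL.le
  have hpath : ∀ ω : Fin n → Fin 4,
      f L / (3 * L) * ((n + 1) - (∑ z ∈ visitedSites ω, (localTime ω z : ℝ) ^ 2) / (12 * L))
        ≤ ∑' z : ℤ × ℤ, f (localTime ω z) := by
    intro ω
    rw [tsum_eq_sum (s := visitedSites ω) fun z hz => by simp [localTime_eq_zero hz, hf0]]
    have hsum : ((n : ℝ) + 1) = ∑ z ∈ visitedSites ω, (localTime ω z : ℝ) := by
      exact_mod_cast (sum_localTime ω).symm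
    rw [hsum, sum_div, ← sum_sub_distrib, mul_sum]
    exact sum_le_sum fun z _ =>
      mul_sub_sq_le_of_monotoneOn hmono.monotoneOn hnonneg hhom hL (Nat.cast_nonneg _)
  rw [expectSRW, le_div_iff₀ (by positivity)]
  refine le_trans ?_ (sum_le_sum fun ω _ => hpath ω)
  rw [← mul_sum, sum_sub_distrib, ← sum_div, sum_const, card_univ, nsmul_eq_mul]
  have hcard : ((Fintype.card (Fin n → Fin 4) : ℕ) : ℝ) = 4 ^ n := by simp
  rw [hcard]
  have hsq : (∑ ω : Fin n → Fin 4, ∑ z ∈ visitedSites ω, (localTime ω z : ℝ) ^ 2) / (12 * L)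
      ≤ 4 ^ n * ((n + 1) / 2) := by
    rw [div_le_iff₀ (by positivity)]
    calc _ ≤ _ := sum_paths_sum_localTime_sq_le n
      _ ≤ 4 ^ n * (((n : ℝ) + 1) * (2 * (L + 2 * L))) := by gcongr
      _ = _ := by ring
  calc 1 / 6 * f L * n / L * 4 ^ n = f L / (3 * L) * (4 ^ n * (n / 2)) := by field_simp; ring
    _ ≤ f L / (3 * L) * (4 ^ n * (n + 1) - 4 ^ n * ((n + 1) / 2)) := by
      gcongr
      have : (0 : ℝ) < 4 ^ n := by positivity
      linarith
    _ ≤ _ := by gcongr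
end

section
/- Let G be a group with finite symmetric generating set S and word length l, and let μ be a symmetric probability measure on G supported on S ∪ {e} whose support generates G. Let v = lim_{n→∞} ln(v(n))/n be the exponential growth rate of G. Then for every ε > 0 there exists C > 0 such that for all n ≥ 1, H(n) ≤ (v + ε)·L(n) + ln(n) + C. -/
noncomputable def wordLength {G : Type*} [Group G] (S : Finset G) (g : G) : ℕ :=
  sInf {n | ∃ l : List G, l.length = n ∧ (∀ x ∈ l, x ∈ S) ∧ l.prod = g}

open Classical in
/-- The `n`-fold convolution power `μ^{*n}` of a measure `μ` on the group `G`
(with `μ^{*0} = δ_e`). -/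
noncomputable def convPow {G : Type*} [Group G] (μ : G → ℝ) : ℕ → G → ℝ
  | 0 => fun g => if g = 1 then (1 : ℝ) else 0
  | (n + 1) => fun g => ∑' h : G, convPow μ n h * μ (h⁻¹ * g)

/-- The entropy `H n = -Σ_g μ^{*n}(g) ln μ^{*n}(g)` of the random walk with step
distribution `μ`. -/
noncomputable def entropy {G : Type*} [Group G] (μ : G → ℝ) (n : ℕ) : ℝ :=
  -∑' g : G, convPow μ n g * Real.log (convPow μ n g)

/-- The drift `L n = Σ_g μ^{*n}(g) l(g)` of the random walk with step distribution `μ`,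
where `l` is the word length relative to `S`. -/
noncomputable def driftMeas {G : Type*} [Group G] (S : Finset G) (μ : G → ℝ) (n : ℕ) : ℝ :=
  ∑' g : G, convPow μ n g * (wordLength S g : ℝ)

/-- The growth function `v n = #{g : l(g) ≤ n}`. -/
noncomputable def growth {G : Type*} [Group G] (S : Finset G) (n : ℕ) : ℕ :=
  Set.ncard {g : G | wordLength S g ≤ n}

open Filter

theorem wordLength_witness {G : Type*} [Group G] {S : Finset G}
    (hS_sym : ∀ x ∈ S, x⁻¹ ∈ S) (hS_gen : Subgroup.closure (S : Set G) = ⊤) (g : G) :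
    ∃ l : List G, l.length = wordLength S g ∧ (∀ x ∈ l, x ∈ S) ∧ l.prod = g := by
  have hg : g ∈ (Subgroup.closure (S : Set G)).toSubmonoid := hS_gen ▸ Subgroup.mem_top g
  rw [Subgroup.closure_toSubmonoid] at hg
  obtain ⟨l, hl, hp⟩ := Submonoid.exists_list_of_mem_closure hg
  exact Nat.sInf_mem (s := {n | ∃ l : List G, l.length = n ∧ (∀ x ∈ l, x ∈ S) ∧ l.prod = g})
    ⟨l.length, l, rfl, fun x hx => (hl x hx).elim id fun h => by simpa using hS_sym _ h, hp⟩

theorem finite_wordLength_le {G : Type*} [Group G] {S : Finset G}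
    (hS_sym : ∀ x ∈ S, x⁻¹ ∈ S) (hS_gen : Subgroup.closure (S : Set G) = ⊤) (n : ℕ) :
    {g : G | wordLength S g ≤ n}.Finite := by
  refine ((List.finite_length_le S n).image
    fun l : List S => (l.map Subtype.val).prod).subset fun g hg => ?_
  obtain ⟨l, hl, hlS, hp⟩ := wordLength_witness hS_sym hS_gen g
  lift l to List S using hlS
  refine ⟨l, ?_, hp⟩
  rw [List.length_map] at hl
  exact hl.trans_le hg

theorem summable_growth_mul_exp {G : Type*} [Group G] {S : Finset G} {v a : ℝ} (ha : v < a)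
    (hv : Tendsto (fun n : ℕ => Real.log (growth S n) / n) atTop (nhds v)) :
    Summable fun n : ℕ => (growth S n : ℝ) * Real.exp (-a * n) := by
  obtain ⟨b, hvb, hba⟩ := exists_between ha
  refine Summable.of_norm_bounded_eventually_nat
    (Real.summable_exp_nat_mul_iff.2 (sub_neg.2 hba)) ?_
  filter_upwards [hv.eventually_lt_const hvb, eventually_gt_atTop 0] with n hn hn0
  have hn0' : (0 : ℝ) < n := by exact_mod_cast hn0
  rw [div_lt_iff₀ hn0'] at hn
  rw [Real.norm_of_nonneg (by positivity)]
  calc (growth S n : ℝ) * Real.exp (-a * n)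
      ≤ Real.exp (b * n) * Real.exp (-a * n) := by
        gcongr
        exact (Real.le_exp_log _).trans (Real.exp_le_exp.2 hn.le)
    _ = Real.exp (n * (b - a)) := by rw [← Real.exp_add]; congr 1; ring

theorem sum_exp_neg_wordLength_le {G : Type*} [Group G] {S : Finset G}
    (hS_sym : ∀ x ∈ S, x⁻¹ ∈ S) (hS_gen : Subgroup.closure (S : Set G) = ⊤) {a : ℝ}
    (ha : Summable fun n : ℕ => (growth S n : ℝ) * Real.exp (-a * n)) (F : Finset G) :
    ∑ g ∈ F, Real.exp (-a * wordLength S g) ≤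
      ∑' n : ℕ, (growth S n : ℝ) * Real.exp (-a * n) := by
  classical
  rw [← Finset.sum_fiberwise_of_maps_to' (t := F.image (wordLength S))
    (fun g hg => Finset.mem_image_of_mem _ hg) (fun n : ℕ => Real.exp (-a * n))]
  refine le_trans (Finset.sum_le_sum fun n _ => ?_)
    (ha.sum_le_tsum _ fun n _ => by positivity)
  rw [Finset.sum_const, nsmul_eq_mul]
  gcongr
  rw [growth, ← Set.ncard_coe_finset]
  refine Set.ncard_le_ncard (fun g hg => ?_) (finite_wordLength_le hS_sym hS_gen n)
  exact (Finset.mem_filter.1 hg).2.le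

theorem convPow_nonneg {G : Type*} [Group G] {μ : G → ℝ} (hμ : ∀ g, 0 ≤ μ g) (n : ℕ) (g : G) :
    0 ≤ convPow μ n g := by
  induction n generalizing g with
  | zero => simp only [convPow]; split_ifs <;> norm_num
  | succ n ih => exact tsum_nonneg fun h => mul_nonneg (ih h) (hμ _)

theorem finite_support_convPow {G : Type*} [Group G] {μ : G → ℝ}
    (hμ : (Function.support μ).Finite) (n : ℕ) : (Function.support (convPow μ n)).Finite := by
  induction n with
  | zero =>
    refine (Set.finite_singleton (1 : G)).subset fun g hg => ?_
    by_contra h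
    exact hg (if_neg h)
  | succ n ih =>
    refine (ih.image2 (fun h k => h * k) hμ).subset fun g hg => ?_
    by_contra hcon
    refine hg ((tsum_congr fun h => ?_).trans tsum_zero)
    by_contra hne
    exact hcon ⟨h, left_ne_zero_of_mul hne, h⁻¹ * g, right_ne_zero_of_mul hne,
      mul_inv_cancel_left h g⟩

theorem hasSum_convPow {G : Type*} [Group G] {μ : G → ℝ} (hμ : ∀ g, 0 ≤ μ g)
    (hsum : HasSum μ 1) (n : ℕ) : HasSum (convPow μ n) 1 := by
  induction n with
  | zero =>
    classical
    convert hasSum_ite_eq (1 : G) (1 : ℝ)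
    simp only [convPow]
  | succ n ih =>
    have hprod : HasSum (fun x : G × G => convPow μ n x.1 * μ x.2) 1 := by
      have hs := ih.summable.mul_of_nonneg hsum.summable (convPow_nonneg hμ n) hμ
      simpa using HasSum.mul ih hsum hs
    let e : G × G ≃ G × G :=
      { toFun := fun x => (x.2, x.2⁻¹ * x.1)
        invFun := fun x => (x.1 * x.2, x.1)
        left_inv := fun x => by simp
        right_inv := fun x => by simp }
    have he := e.hasSum_iff.2 hprod
    exact he.prod_fiberwise fun g => (he.summable.prod_factor g).hasSum

/-- Let `G` be a group with finite symmetric generating set `S` and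
word length `l`, and let `μ` be a symmetric probability measure on `G` supported on
`S ∪ {e}` whose support generates `G`.  Let `v` be the exponential growth rate of `G`,
i.e. `v = lim_{n→∞} ln (v n) / n`.  Then for every `ε > 0` there exists `C > 0` such
that for all `n ≥ 1`, `H n ≤ (v + ε) · L n + ln n + C`. -/
theorem entropy_le_drift_growth {G : Type*} [Group G] (S : Finset G)
    (hS_sym : ∀ x ∈ S, x⁻¹ ∈ S) (hS_gen : Subgroup.closure (S : Set G) = ⊤)
    (μ : G → ℝ)
    (hμ_nonneg : ∀ g, 0 ≤ μ g)
    (hμ_total : ∑' g : G, μ g = 1)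
    (hμ_symm : ∀ g, μ g⁻¹ = μ g)
    (hμ_supp : Function.support μ ⊆ (S : Set G) ∪ {1})
    (hμ_gen : Subgroup.closure (Function.support μ) = ⊤)
    (v : ℝ)
    (hv : Filter.Tendsto (fun n : ℕ => Real.log (growth S n) / n)
      Filter.atTop (nhds v)) :
    ∀ ε > (0 : ℝ), ∃ C > (0 : ℝ), ∀ n : ℕ, 1 ≤ n →
      entropy μ n ≤ (v + ε) * driftMeas S μ n + Real.log n + C := by
  intro ε hε
  have hμ_fin : (Function.support μ).Finite :=
    (S.finite_toSet.union (Set.finite_singleton 1)).subset hμ_supp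
  have hμ_sum : HasSum μ 1 := hμ_total ▸ (summable_of_hasFiniteSupport hμ_fin).hasSum
  have hsum := summable_growth_mul_exp (lt_add_of_pos_right v hε) hv
  set Z := ∑' n : ℕ, (growth S n : ℝ) * Real.exp (-(v + ε) * n)
  have hZ : 0 ≤ Z := tsum_nonneg fun n => by positivity
  refine ⟨Z + 1, by positivity, fun n _ => ?_⟩
  have hlog : 0 ≤ Real.log n := Real.log_natCast_nonneg n
  set F := (finite_support_convPow hμ_fin n).toFinset
  have hF : ∀ g ∉ F, convPow μ n g = 0 := fun g hg => by simpa [F] using hg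
  have hone : ∑ g ∈ F, convPow μ n g = 1 := by
    rw [← tsum_eq_sum (L := .unconditional G) hF, (hasSum_convPow hμ_nonneg hμ_sum n).tsum_eq]
  have hL : driftMeas S μ n = ∑ g ∈ F, convPow μ n g * (wordLength S g : ℝ) :=
    tsum_eq_sum fun g hg => by rw [hF g hg, zero_mul]
  have hH : entropy μ n = -∑ g ∈ F, convPow μ n g * Real.log (convPow μ n g) :=
    congrArg Neg.neg (tsum_eq_sum (s := F) (L := .unconditional G) fun g hg => by
      rw [hF g hg, zero_mul])
  have hgibbs : ∀ g ∈ F, -(v + ε) * (convPow μ n g * (wordLength S g : ℝ)) -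
      convPow μ n g * Real.log (convPow μ n g) ≤
      Real.exp (-(v + ε) * wordLength S g) - convPow μ n g := by
    intro g hg
    have hp : 0 < convPow μ n g :=
      (convPow_nonneg hμ_nonneg n g).lt_of_ne' (by simpa [F] using hg)
    set q := Real.exp (-(v + ε) * wordLength S g)
    have hqp : 0 < q := Real.exp_pos _
    have hlq : Real.log q = -(v + ε) * wordLength S g := Real.log_exp _
    have h := mul_le_mul_of_nonneg_left (Real.log_le_sub_one_of_pos (div_pos hqp hp)) hp.le
    rw [Real.log_div hqp.ne' hp.ne', hlq, mul_sub, mul_sub, mul_div_cancel₀ _ hp.ne'] at h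
    linarith
  have hmain := Finset.sum_le_sum hgibbs
  rw [Finset.sum_sub_distrib, Finset.sum_sub_distrib, ← Finset.mul_sum, ← hL, hone] at hmain
  have hZF := sum_exp_neg_wordLength_le hS_sym hS_gen hsum F
  rw [hH]
  linarith
end
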